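/- Let 0 < ε ≤ M and let ν̃ be the measure on ℝ with density y ↦ y^{−2} (for y ≠ 0) with respect to Lebesgue measure. For λ ∈ [ε, M] let ρ_λ(y) = e^{−λy²}, and let ρ̄_{λ,m} be the grid discretization of ρ_λ with respect to ν̃. Then lim_{m→∞} sup_{λ ∈ [ε,M]} ∫_ℝ |ρ_λ(y) − ρ̄_{λ,m}(y)| ν̃(dy) = 0. -/

import Mathlib

open MeasureTheory

/-- The grid cell of the partition of level `m` containing the point `y`:
`J_{-∞} = (-∞, -m]` if `y ≤ -m`, `J_∞ = (m, ∞)` if `y > m`, and otherwise the unique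
grid interval `J_{j,k} = (k + (j-1)/m, k + j/m] = ((i-1)/m, i/m]` (with `i = ⌈my⌉`)
containing `y`. -/
noncomputable def gridCell (m : ℕ) (y : ℝ) : Set ℝ :=
  if y ≤ -(m : ℝ) then Set.Iic (-(m : ℝ))
  else if (m : ℝ) < y then Set.Ioi (m : ℝ)
  else Set.Ioc ((((⌈(m : ℝ) * y⌉ : ℤ) : ℝ) - 1) / m) (((⌈(m : ℝ) * y⌉ : ℤ) : ℝ) / m)

/-- The grid discretization `ρ̄ₘ` of `ρ` with respect to the measure `ν`: it equals `1`
on `(-1/m, 1/m]`, and on every other grid cell `J` it equals the constant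
`ν(J)/ν̃(J) = (∫_J ρ dν̃)/ν̃(J)`, with the convention that it equals `1` on cells of
`ν̃`-measure zero. -/
noncomputable def gridDisc (m : ℕ) (ν : Measure ℝ) (ρ : ℝ → ℝ) (y : ℝ) : ℝ :=
  if y ∈ Set.Ioc (-(1 / (m : ℝ))) (1 / (m : ℝ)) then 1
  else if ν (gridCell m y) = 0 then 1
  else (∫ z in gridCell m y, ρ z ∂ν) / (ν (gridCell m y)).toReal

/-- The dominating measure of Example 2: Lebesgue measure with density `y⁻²`. -/
noncomputable def invSqMeasure : Measure ℝ :=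
  volume.withDensity (fun y => ENNReal.ofReal (1 / y ^ 2))

noncomputable def domFun (K y : ℝ) : ℝ := min 1 (K * y ^ 2)

theorem domFun_integrable (K : ℝ) (hK : 0 < K) : Integrable (domFun K) invSqMeasure := by
  unfold invSqMeasure
  have hm : Measurable (fun y : ℝ => ENNReal.ofReal (1 / y ^ 2)) := by fun_prop
  rw [integrable_withDensity_iff hm (by simp)]
  have h := (integrable_inv_one_add_sq).const_mul (1 + K)
  refine h.mono' ?_ ?_
  · unfold domFun
    exact Measurable.aestronglyMeasurable (by fun_prop)
  · refine Filter.Eventually.of_forall fun y => ?_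
    have h0 : 0 ≤ domFun K y := le_min zero_le_one (by positivity)
    rw [ENNReal.toReal_ofReal (by positivity), Real.norm_of_nonneg (by positivity)]
    by_cases hy : y = 0
    · subst hy; simp; positivity
    have hy2 : 0 < y ^ 2 := by positivity
    rw [mul_one_div, ← div_eq_mul_inv, div_le_div_iff₀ hy2 (by positivity)]
    have h1 : domFun K y ≤ 1 := min_le_left _ _
    have h2 : domFun K y ≤ K * y ^ 2 := min_le_right _ _
    nlinarith

theorem invSq_lt_top (a : ℝ) (ha : 0 < a) (J : Set ℝ) (hJ : ∀ z ∈ J, a ≤ |z|) :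
    invSqMeasure J < ⊤ := by
  have h := (domFun_integrable 1 one_pos).measure_ge_lt_top (ε := min 1 (a ^ 2)) (by positivity)
  refine lt_of_le_of_lt (measure_mono ?_) h
  intro z hz
  have h1 := hJ z hz
  have : a ^ 2 ≤ z ^ 2 := by rw [← sq_abs z]; gcongr
  simp only [Set.mem_ofPred_eq, domFun, one_mul]
  exact min_le_min le_rfl this

theorem invSq_ne_zero (a : ℝ) (ha : 0 < a) (J : Set ℝ)
    (hJ : ∀ z ∈ J, a ≤ |z|) (hv : volume J ≠ 0) : invSqMeasure J ≠ 0 := by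
  unfold invSqMeasure
  rw [Ne, withDensity_apply_eq_zero (by fun_prop)]
  convert hv using 3
  ext z
  simp only [Set.mem_inter_iff, Set.mem_ofPred_eq, and_iff_right_iff_imp]
  intro hz
  have h1 : 0 < |z| := ha.trans_le (hJ z hz)
  have h2 : z ≠ 0 := abs_pos.1 h1
  have : 0 < 1 / z ^ 2 := by positivity
  simpa using h2

theorem cell_facts (m : ℕ) (hm : 1 ≤ m) (y : ℝ)
    (hy : y ∉ Set.Ioc (-(1 / (m : ℝ))) (1 / (m : ℝ))) :
    MeasurableSet (gridCell m y) ∧ (∀ z ∈ gridCell m y, 1 / (m : ℝ) ≤ |z|) ∧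
    volume (gridCell m y) ≠ 0 ∧
    ((m : ℝ) ≤ |y| ∨ ∀ z ∈ gridCell m y, |z - y| ≤ 1 / (m : ℝ)) := by
  have hm1 : (1 : ℝ) ≤ m := by exact_mod_cast hm
  have hm0 : (0 : ℝ) < m := by linarith
  have hmm : 1 / (m : ℝ) ≤ m := by rw [div_le_iff₀ hm0]; nlinarith
  unfold gridCell
  split_ifs with h1 h2
  · refine ⟨measurableSet_Iic, ?_, by simp, Or.inl ?_⟩
    · intro z hz
      have := neg_le_abs z
      simp only [Set.mem_Iic] at hz
      linarith
    · have := neg_le_abs y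
      linarith
  · refine ⟨measurableSet_Ioi, ?_, by simp, Or.inl ?_⟩
    · intro z hz
      have := le_abs_self z
      simp only [Set.mem_Ioi] at hz
      linarith
    · have := le_abs_self y
      linarith
  · set i := ⌈(m : ℝ) * y⌉ with hi
    have hi1 : (m : ℝ) * y ≤ i := Int.le_ceil _
    have hi2 : (i : ℝ) < m * y + 1 := Int.ceil_lt_add_one _
    refine ⟨measurableSet_Ioc, ?_, ?_, Or.inr ?_⟩
    · rintro z ⟨hz1, hz2⟩
      rw [div_lt_iff₀ hm0] at hz1
      rw [le_div_iff₀ hm0] at hz2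
      rw [div_le_iff₀ hm0]
      by_cases hc : y ≤ -(1 / (m : ℝ))
      · have h3 : (m : ℝ) * y ≤ ((-1 : ℤ) : ℝ) := by
          have := mul_le_mul_of_nonneg_left hc hm0.le
          have e : (m : ℝ) * -(1 / (m : ℝ)) = -1 := by field_simp
          push_cast; linarith
        have h4 : i ≤ -1 := Int.ceil_le.2 h3
        have h5 : (i : ℝ) ≤ -1 := by exact_mod_cast h4
        have := neg_le_abs z
        nlinarith
      · have h3 : 1 / (m : ℝ) < y := by
          by_contra h
          exact hy ⟨not_le.1 hc, not_lt.1 h⟩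
        rw [div_lt_iff₀ hm0] at h3
        have h4 : 1 < i := Int.lt_ceil.2 (by push_cast; linarith)
        have h5 : (2 : ℝ) ≤ i := by exact_mod_cast h4
        have := le_abs_self z
        nlinarith
    · rw [Real.volume_Ioc]
      have : (i : ℝ) / m - (i - 1) / m = 1 / m := by ring
      rw [this]
      simp only [ne_eq, ENNReal.ofReal_eq_zero, not_le]
      positivity
    · rintro z ⟨hz1, hz2⟩
      rw [div_lt_iff₀ hm0] at hz1
      rw [le_div_iff₀ hm0] at hz2
      rw [le_div_iff₀ hm0, ← abs_of_pos hm0, ← abs_mul, abs_le]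
      constructor <;> nlinarith

theorem exp_neg_diff_le (a b : ℝ) (ha : 0 ≤ a) (hb : 0 ≤ b) :
    |Real.exp (-a) - Real.exp (-b)| ≤ |a - b| := by
  wlog h : a ≤ b generalizing a b
  · rw [abs_sub_comm, abs_sub_comm a b]
    exact this b a hb ha (le_of_not_ge h)
  have h1 : Real.exp (-b) ≤ Real.exp (-a) := Real.exp_le_exp.2 (by linarith)
  rw [abs_of_nonneg (by linarith), abs_sub_comm, abs_of_nonneg (by linarith)]
  have h2 : Real.exp (-b) = Real.exp (-a) * Real.exp (-(b - a)) := by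
    rw [← Real.exp_add]; congr 1; ring
  have h3 := Real.add_one_le_exp (-(b - a))
  have h4 : Real.exp (-a) ≤ 1 := Real.exp_le_one_iff.2 (by linarith)
  have h5 := Real.exp_pos (-a)
  rw [h2]
  nlinarith

theorem exp_neg_diff_le_one (a b : ℝ) (ha : 0 ≤ a) (hb : 0 ≤ b) :
    |Real.exp (-a) - Real.exp (-b)| ≤ 1 := by
  have h4 : Real.exp (-a) ≤ 1 := Real.exp_le_one_iff.2 (by linarith)
  have h5 := Real.exp_pos (-a)
  have h6 : Real.exp (-b) ≤ 1 := Real.exp_le_one_iff.2 (by linarith)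
  have h7 := Real.exp_pos (-b)
  rw [abs_le]; constructor <;> linarith

theorem disc_bound (m : ℕ) (hm : 1 ≤ m) (M l : ℝ) (hl : 0 ≤ l) (hlM : l ≤ M) (y : ℝ) :
    |Real.exp (-(l * y ^ 2)) - gridDisc m invSqMeasure (fun z => Real.exp (-(l * z ^ 2))) y|
      ≤ min (domFun (3 * M + 1) y) ((3 * M + 1) * |y| * (1 / (m : ℝ))) := by
  have hm1 : (1 : ℝ) ≤ m := by exact_mod_cast hm
  have hm0 : (0 : ℝ) < m := by linarith
  have hM : 0 ≤ M := hl.trans hlM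
  have hy0 := abs_nonneg y
  have hsq : y ^ 2 = |y| * |y| := by rw [← sq_abs]; ring
  have hd : 0 < 1 / (m : ℝ) := by positivity
  by_cases hy : y ∈ Set.Ioc (-(1 / (m : ℝ))) (1 / (m : ℝ))
  · rw [gridDisc, if_pos hy]
    have hy1 : |y| ≤ 1 / m := abs_le.2 ⟨hy.1.le, hy.2⟩
    have e1 := exp_neg_diff_le (l * y ^ 2) 0 (by positivity) le_rfl
    have e2 := exp_neg_diff_le_one (l * y ^ 2) 0 (by positivity) le_rfl
    rw [neg_zero, Real.exp_zero] at e1 e2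
    rw [sub_zero, abs_of_nonneg (show 0 ≤ l * y ^ 2 by positivity)] at e1
    have e3 : l * y ^ 2 ≤ (3 * M + 1) * y ^ 2 := by gcongr; linarith
    refine le_min (le_min e2 (e1.trans e3)) (e1.trans (e3.trans ?_))
    rw [hsq, ← mul_assoc]; gcongr
  · obtain ⟨hJm, hJa, hJv, hJ⟩ := cell_facts m hm y hy
    have hfin := invSq_lt_top _ hd _ hJa
    have hne := invSq_ne_zero _ hd _ hJa hJv
    rw [gridDisc, if_neg hy, if_neg hne]
    have hya : 1 / (m : ℝ) ≤ |y| := by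
      by_contra hc
      have := abs_lt.1 (not_le.1 hc)
      exact hy ⟨this.1, this.2.le⟩
    have key : ∀ c : ℝ, (∀ z ∈ gridCell m y,
        |Real.exp (-(l * y ^ 2)) - Real.exp (-(l * z ^ 2))| ≤ c) →
        |Real.exp (-(l * y ^ 2)) - (∫ z in gridCell m y, Real.exp (-(l * z ^ 2)) ∂invSqMeasure) /
          (invSqMeasure (gridCell m y)).toReal| ≤ c := by
      intro c hc
      have hint : IntegrableOn (fun z => Real.exp (-(l * z ^ 2))) (gridCell m y) invSqMeasure := by
        refine Measure.integrableOn_of_bounded (M := 1) hfin.ne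
          (Measurable.aestronglyMeasurable (by fun_prop)) ?_
        refine Filter.Eventually.of_forall fun z => ?_
        rw [Real.norm_of_nonneg (Real.exp_pos _).le]
        exact Real.exp_le_one_iff.2 (by have : 0 ≤ l * z ^ 2 := by positivity
                                        linarith)
      have hmem := (convex_closedBall (Real.exp (-(l * y ^ 2))) c).set_average_mem
        Metric.isClosed_closedBall hne hfin.ne
        (f := fun z => Real.exp (-(l * z ^ 2)))
        ((ae_restrict_iff' hJm).2 (Filter.Eventually.of_forall fun z hz => by
          rw [Metric.mem_closedBall, dist_comm]; exact hc z hz)) hint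
      rw [setAverage_eq, Metric.mem_closedBall, dist_comm, Real.dist_eq, smul_eq_mul,
        ← div_eq_inv_mul] at hmem
      exact hmem
    have k1 := key 1 (fun z _ => exp_neg_diff_le_one _ _ (by positivity) (by positivity))
    rcases hJ with hJ | hJ
    · have a1 : 1 ≤ |y| * (1 / (m : ℝ)) := by
        rw [mul_one_div, le_div_iff₀ hm0]; linarith
      have a2 : 1 ≤ (3 * M + 1) * |y| * (1 / (m : ℝ)) := by nlinarith
      have a3 : (3 * M + 1) * |y| * (1 / (m : ℝ)) ≤ (3 * M + 1) * y ^ 2 := by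
        rw [hsq, ← mul_assoc]; gcongr
      exact le_min (le_min k1 (k1.trans (a2.trans a3))) (k1.trans a2)
    · have k2 := key ((3 * M + 1) * |y| * (1 / (m : ℝ))) (fun z hz => by
        refine (exp_neg_diff_le _ _ (by positivity) (by positivity)).trans ?_
        have b1 := hJ z hz
        have b2 : |z + y| ≤ 3 * |y| := by
          have : z + y = (z - y) + (y + y) := by ring
          rw [this]
          refine (abs_add_le _ _).trans ?_
          have := abs_add_le y y
          linarith
        have : l * y ^ 2 - l * z ^ 2 = -(l * ((z + y) * (z - y))) := by ring
        rw [this, abs_neg, abs_mul, abs_mul, abs_of_nonneg hl]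
        calc l * (|z + y| * |z - y|) ≤ M * ((3 * |y|) * (1 / m)) := by gcongr
          _ = (3 * M) * |y| * (1 / m) := by ring
          _ ≤ _ := by gcongr; linarith)
      have a3 : (3 * M + 1) * |y| * (1 / (m : ℝ)) ≤ (3 * M + 1) * y ^ 2 := by
        rw [hsq, ← mul_assoc]; gcongr
      exact le_min (le_min k1 (k2.trans a3)) k2

theorem dom_tendsto (K : ℝ) (hK : 0 < K) :
    Filter.Tendsto (fun m : ℕ => ∫ y, min (domFun K y) (K * |y| * (1 / (m : ℝ))) ∂invSqMeasure)
      Filter.atTop (nhds 0) := by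
  have h0 : ∀ y, 0 ≤ domFun K y := fun y => le_min zero_le_one (by positivity)
  have : (0 : ℝ) = ∫ y, (0 : ℝ) ∂invSqMeasure := by simp
  rw [this]
  refine tendsto_integral_of_dominated_convergence (domFun K) ?_ (domFun_integrable K hK) ?_ ?_
  · intro m
    unfold domFun
    exact Measurable.aestronglyMeasurable (by fun_prop)
  · intro m
    refine Filter.Eventually.of_forall fun y => ?_
    rw [Real.norm_of_nonneg (le_min (h0 y) (by positivity))]
    exact min_le_left _ _
  · refine Filter.Eventually.of_forall fun y => ?_
    have h1 : Filter.Tendsto (fun m : ℕ => K * |y| * (1 / (m : ℝ))) Filter.atTop (nhds 0) := by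
      simpa using (tendsto_one_div_atTop_nhds_zero_nat (𝕜 := ℝ)).const_mul (K * |y|)
    exact squeeze_zero (fun m => le_min (h0 y) (by positivity)) (fun m => min_le_right _ _) h1

/-- Condition (M3) for Example 2: with `ν̃` of density `y⁻²` and `ρ_λ(y) = e^{-λy²}`,
the `L¹(ν̃)` distance between `ρ_λ` and its grid discretization tends to `0` as
`m → ∞`, uniformly over `λ ∈ [ε, M]`. -/
theorem tendsto_iSup_integral_abs_gauss_sub_gridDisc (ε M : ℝ) (hε : 0 < ε) (hεM : ε ≤ M) :
    Filter.Tendsto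
      (fun m : ℕ =>
        ⨆ l : Set.Icc ε M,
          ∫ y, |Real.exp (-((l : ℝ) * y ^ 2)) -
              gridDisc m invSqMeasure (fun z => Real.exp (-((l : ℝ) * z ^ 2))) y|
            ∂invSqMeasure)
      Filter.atTop (nhds 0) := by
  have hM : 0 < M := hε.trans_le hεM
  have hK : 0 < 3 * M + 1 := by positivity
  have : Nonempty (Set.Icc ε M) := ⟨⟨ε, le_rfl, hεM⟩⟩
  refine tendsto_of_tendsto_of_tendsto_of_le_of_le' tendsto_const_nhds
    (dom_tendsto (3 * M + 1) hK) ?_ ?_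
  · exact Filter.Eventually.of_forall fun m =>
      Real.iSup_nonneg fun l => integral_nonneg fun y => abs_nonneg _
  · filter_upwards [Filter.eventually_ge_atTop 1] with m hm
    refine ciSup_le fun l => ?_
    refine integral_mono_of_nonneg (Filter.Eventually.of_forall fun y => abs_nonneg _) ?_
      (Filter.Eventually.of_forall fun y => disc_bound m hm M l (hε.le.trans l.2.1) l.2.2 y)
    refine (domFun_integrable (3 * M + 1) hK).mono' ?_ ?_
    · unfold domFun
      exact Measurable.aestronglyMeasurable (by fun_prop)
    · refine Filter.Eventually.of_forall fun y => ?_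
      have h0 : 0 ≤ domFun (3 * M + 1) y := le_min zero_le_one (by positivity)
      rw [Real.norm_of_nonneg (le_min h0 (by positivity))]
      exact min_le_left _ _
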